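/- arXiv:2202.01300 — 9 statements merged into one kernel-verified Lean document; each statement's English description precedes it below -/
import Mathlib

section
/- (Proposition 1) Let π_X, π_Y ∈ (0,1) and p₀₀, p₀₁, p'₀₀, p'₀₁ ∈ [0,1]. Suppose there exist c ∈ Δ^15 and λ_A, λ_B ∈ ℝ such that A(π_Y)·c = a_{p₀₀,p₀₁}(λ_A) and B(π_X)·c = a_{p'₀₀,p'₀₁}(λ_B). Then there exists c* ∈ Δ^15 such that A(π_Y)·c* = a_{p₀₀,p₀₁}(min(p₀₀,p₀₁)) and B(π_X)·c* = a_{p'₀₀,p'₀₁}(min(p'₀₀,p'₀₁)). That is, if the structural causal marginal problem is feasible at all, it is feasible at the maximal values λ_A^max = min(p₀₀,p₀₁) and λ_B^max = min(p'₀₀,p'₀₁) simultaneously. -/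
/-- The four Boolean response functions: `f₀ ≡ 0`, `f₁ ≡ 1`, `f₂ = id`, `f₃ = not`. -/
def fRes : Fin 4 → Bool → Bool := ![fun _ => false, fun _ => true, fun x => x, fun x => !x]

/-- The sixteen joint response functions `h_k(x,y) = (k / 2^(2x+y)) % 2`. -/
def hRes (k : Fin 16) (x y : Bool) : Bool :=
  (((k : ℕ) / 2 ^ (2 * x.toNat + y.toNat)) % 2) == 1

/-- The 4×16 marginalisation matrix `A(π)` with entries
`A(π)_{jk} = (1−π)·1{h_k(·,0)=f_j} + π·1{h_k(·,1)=f_j}`. -/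
noncomputable def Amat (p : ℝ) : Matrix (Fin 4) (Fin 16) ℝ :=
  Matrix.of fun j k =>
    (1 - p) * (if (fun x => hRes k x false) = fRes j then (1 : ℝ) else 0)
      + p * (if (fun x => hRes k x true) = fRes j then (1 : ℝ) else 0)

/-- The 4×16 marginalisation matrix `B(π)` with entries
`B(π)_{jk} = (1−π)·1{h_k(0,·)=f_j} + π·1{h_k(1,·)=f_j}`. -/
noncomputable def Bmat (p : ℝ) : Matrix (Fin 4) (Fin 16) ℝ :=
  Matrix.of fun j k =>
    (1 - p) * (if (fun y => hRes k false y) = fRes j then (1 : ℝ) else 0)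
      + p * (if (fun y => hRes k true y) = fRes j then (1 : ℝ) else 0)

/-- `a_{p,q}(λ) = (λ, 1−p−q+λ, p−λ, q−λ)`. -/
def avec (p q lam : ℝ) : Fin 4 → ℝ := ![lam, 1 - p - q + lam, p - lam, q - lam]

/-- The mass that `c` gives to the response functions vanishing at both `(x, y)` and `(x', y')`. -/
def zeroMass (c : Fin 16 → ℝ) (x y x' y' : Bool) : ℝ :=
  ∑ k with hRes k x y = false ∧ hRes k x' y' = false, c k

/-- The law of a random function `g k : Bool → Bool` is determined by its zero probabilities. -/
lemma sum_eq_fRes_eq_avec {c : Fin 16 → ℝ} (hc : ∑ k, c k = 1) (g : Fin 16 → Bool → Bool)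
    (j : Fin 4) :
    ∑ k with g k = fRes j, c k =
      avec (∑ k with g k false = false ∧ g k false = false, c k)
        (∑ k with g k true = false ∧ g k true = false, c k)
        (∑ k with g k false = false ∧ g k true = false, c k) j := by
  simp only [Finset.sum_filter]
  fin_cases j <;>
    simp only [avec, fRes, ← hc, ← Finset.sum_sub_distrib, ← Finset.sum_add_distrib, Fin.zero_eta,
      Fin.mk_one, Fin.reduceFinMk, Matrix.cons_val] <;>
    refine Finset.sum_congr rfl fun k _ ↦ ?_ <;>
    simp only [funext_iff, Bool.forall_bool] <;>
    cases g k false <;> cases g k true <;> simp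

lemma mix_avec (t p q l p' q' l' : ℝ) (j : Fin 4) :
    (1 - t) * avec p q l j + t * avec p' q' l' j =
      avec ((1 - t) * p + t * p') ((1 - t) * q + t * q') ((1 - t) * l + t * l') j := by
  fin_cases j <;> simp [avec] <;> ring

lemma avec_inj {p q l p' q' l' : ℝ} (h : avec p q l = avec p' q' l') : p = p' ∧ q = q' := by
  have h0 := congrFun h 0
  have h2 := congrFun h 2
  have h3 := congrFun h 3
  simp only [avec, Matrix.cons_val] at h0 h2 h3
  constructor <;> linarith

lemma mulVec_mix_indicator (t : ℝ) (c : Fin 16 → ℝ) (f g : Fin 16 → Bool → Bool) (j : Fin 4) :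
    ∑ k, ((1 - t) * (if f k = fRes j then (1 : ℝ) else 0) +
        t * (if g k = fRes j then (1 : ℝ) else 0)) * c k =
      (1 - t) * (∑ k with f k = fRes j, c k) + t * ∑ k with g k = fRes j, c k := by
  simp only [Finset.sum_filter, Finset.mul_sum, ← Finset.sum_add_distrib]
  refine Finset.sum_congr rfl fun k _ ↦ ?_
  split_ifs <;> ring

lemma Amat_mulVec (t : ℝ) {c : Fin 16 → ℝ} (hc : ∑ k, c k = 1) :
    (Amat t).mulVec c =
      avec ((1 - t) * zeroMass c false false false false + t * zeroMass c false true false true)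
        ((1 - t) * zeroMass c true false true false + t * zeroMass c true true true true)
        ((1 - t) * zeroMass c false false true false +
          t * zeroMass c false true true true) := by
  ext j
  rw [← mix_avec]
  exact (mulVec_mix_indicator t c _ _ j).trans <| congrArg₂ _
    (congrArg _ <| sum_eq_fRes_eq_avec hc (fun k x ↦ hRes k x false) j)
    (congrArg _ <| sum_eq_fRes_eq_avec hc (fun k x ↦ hRes k x true) j)

lemma Bmat_mulVec (t : ℝ) {c : Fin 16 → ℝ} (hc : ∑ k, c k = 1) :
    (Bmat t).mulVec c =
      avec ((1 - t) * zeroMass c false false false false + t * zeroMass c true false true false)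
        ((1 - t) * zeroMass c false true false true + t * zeroMass c true true true true)
        ((1 - t) * zeroMass c false false false true +
          t * zeroMass c true false true true) := by
  ext j
  rw [← mix_avec]
  exact (mulVec_mix_indicator t c _ _ j).trans <| congrArg₂ _
    (congrArg _ <| sum_eq_fRes_eq_avec hc (fun k y ↦ hRes k false y) j)
    (congrArg _ <| sum_eq_fRes_eq_avec hc (fun k y ↦ hRes k true y) j)

lemma zeroMass_mem_Icc {c : Fin 16 → ℝ} (hc : c ∈ stdSimplex ℝ (Fin 16)) (x y x' y' : Bool) :
    zeroMass c x y x' y' ∈ Set.Icc (0 : ℝ) 1 := by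
  refine ⟨Finset.sum_nonneg fun k _ ↦ hc.1 k, ?_⟩
  rw [← hc.2]
  exact Finset.sum_le_sum_of_subset_of_nonneg (Finset.filter_subset _ _) fun k _ _ ↦ hc.1 k

lemma hRes_injective : Function.Injective hRes := by decide

lemma hRes_surjective : Function.Surjective hRes := by
  intro f
  have key : ∀ a b c d : Bool, ∃ k, hRes k false false = a ∧ hRes k false true = b ∧
      hRes k true false = c ∧ hRes k true true = d := by decide
  obtain ⟨k, h₁, h₂, h₃, h₄⟩ :=
    key (f false false) (f false true) (f true false) (f true true)
  refine ⟨k, ?_⟩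
  ext x y
  cases x <;> cases y <;> simp_all

open MeasureTheory in
/-- The comonotone coupling: any four zero probabilities are realised by a law on joint response
functions under which the zero events are nested. -/
lemma exists_comonotone_coupling {m : Bool → Bool → ℝ} (hm : ∀ x y, m x y ∈ Set.Icc (0 : ℝ) 1) :
    ∃ c ∈ stdSimplex ℝ (Fin 16), ∀ x y x' y', zeroMass c x y x' y' = min (m x y) (m x' y') := by
  let S : Fin 16 → Set ℝ := fun k ↦
    Set.Ico 0 1 ∩ ⋂ x, ⋂ y, {u | hRes k x y = decide (m x y ≤ u)}
  have hS (k : Fin 16) : MeasurableSet (S k) := by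
    refine measurableSet_Ico.inter <| .iInter fun x ↦ .iInter fun y ↦ ?_
    cases hRes k x y
    · simp only [Bool.false_eq, decide_eq_false_iff_not, not_le]
      exact measurableSet_Iio
    · simp only [Bool.true_eq, decide_eq_true_eq]
      exact measurableSet_Ici
  have hsum (Q : (Bool → Bool → Bool) → Prop) [DecidablePred Q] :
      ∑ k with Q (hRes k), volume.real (S k) =
        volume.real {u ∈ Set.Ico (0 : ℝ) 1 | Q fun x y ↦ decide (m x y ≤ u)} := by
    rw [← measureReal_biUnion_finset (h := fun k _ ↦
      ((measure_mono Set.inter_subset_left).trans_lt measure_Ico_lt_top).ne)]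
    · congr 1
      ext u
      simp only [Set.mem_iUnion, Set.mem_inter_iff, Set.mem_iInter, Set.mem_ofPred_eq,
        Finset.mem_filter, Finset.mem_univ, true_and]
      constructor
      · rintro ⟨k, hQ, hu, h⟩
        have : hRes k = fun x y ↦ decide (m x y ≤ u) := by ext x y; rw [h]
        exact ⟨hu, this ▸ hQ⟩
      · rintro ⟨hu, hQ⟩
        obtain ⟨k, hk⟩ := hRes_surjective fun x y ↦ decide (m x y ≤ u)
        exact ⟨k, hk ▸ hQ, hu, fun x y ↦ by rw [hk]⟩
    · intro k _ l _ hkl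
      refine Set.disjoint_left.2 fun u hk hl ↦ hkl <| hRes_injective ?_
      simp only [Set.mem_inter_iff, Set.mem_iInter, Set.mem_ofPred_eq] at hk hl
      ext x y
      rw [hk.2, hl.2]
    · exact fun k _ ↦ hS k
  refine ⟨fun k ↦ volume.real (S k), ⟨fun k ↦ measureReal_nonneg, ?_⟩, fun x y x' y' ↦ ?_⟩
  · have := hsum fun _ ↦ True
    simp only [Finset.filter_true, and_true] at this
    rw [this]
    exact (Real.volume_real_Ico_of_le zero_le_one).trans (sub_zero 1)
  · have hset : {u ∈ Set.Ico (0 : ℝ) 1 | decide (m x y ≤ u) = false ∧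
        decide (m x' y' ≤ u) = false} = Set.Ico 0 (min (m x y) (m x' y')) := by
      ext u
      have := (hm x y).2
      simp only [Set.mem_ofPred_eq, Set.mem_Ico, decide_eq_false_iff_not, not_le, lt_min_iff]
      exact ⟨fun h ↦ ⟨h.1.1, h.2⟩, fun h ↦ ⟨⟨h.1, h.2.1.trans_le this⟩, h.2⟩⟩
    refine (hsum fun h ↦ h x y = false ∧ h x' y' = false).trans ?_
    rw [hset, Real.volume_real_Ico_of_le (le_min (hm x y).1 (hm x' y').1), sub_zero]

/-- `m'` has the same weighted row and column averages as `m`. -/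
def SameAverages (a b : ℝ) (m m' : Bool → Bool → ℝ) : Prop :=
  (∀ x, (1 - a) * m' x false + a * m' x true = (1 - a) * m x false + a * m x true) ∧
    ∀ y, (1 - b) * m' false y + b * m' true y = (1 - b) * m false y + b * m true y

/-- The case where the row `true` has the largest of the four averages. -/
lemma exists_monotone_of_col_le_row {a b : ℝ} (ha : a ∈ Set.Ioo (0 : ℝ) 1)
    (hb : b ∈ Set.Ioo (0 : ℝ) 1) {m : Bool → Bool → ℝ} (hm : ∀ x y, m x y ∈ Set.Icc (0 : ℝ) 1)
    (hcol : (1 - b) * m false false + b * m true false ≤ (1 - b) * m false true + b * m true true)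
    (hle : (1 - b) * m false true + b * m true true ≤
      (1 - a) * m true false + a * m true true) :
    ∃ m' : Bool → Bool → ℝ, (∀ x y, m' x y ∈ Set.Icc (0 : ℝ) 1) ∧ SameAverages a b m m' ∧
      (∀ y, m' false y ≤ m' true y) ∧ ∀ x, m' x false ≤ m' x true := by
  obtain ⟨ha0, ha1⟩ := ha
  obtain ⟨hb0, hb1⟩ := hb
  have ha1' : 0 < 1 - a := sub_pos.2 ha1
  have hb1' : 0 < 1 - b := sub_pos.2 hb1
  obtain ⟨h00, h00'⟩ := hm false false
  obtain ⟨h01, h01'⟩ := hm false true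
  obtain ⟨h10, h10'⟩ := hm true false
  obtain ⟨h11, h11'⟩ := hm true true
  suffices ∃ v00 v01 v10 v11 : ℝ, 0 ≤ v00 ∧ v00 ≤ v01 ∧ v00 ≤ v10 ∧ v01 ≤ v11 ∧ v10 ≤ v11 ∧
      v11 ≤ 1 ∧
      (1 - a) * v00 + a * v01 = (1 - a) * m false false + a * m false true ∧
      (1 - a) * v10 + a * v11 = (1 - a) * m true false + a * m true true ∧
      (1 - b) * v00 + b * v10 = (1 - b) * m false false + b * m true false ∧
      (1 - b) * v01 + b * v11 = (1 - b) * m false true + b * m true true by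
    obtain ⟨v00, v01, v10, v11, h0, h1, h2, h3, h4, h5, e1, e2, e3, e4⟩ := this
    refine ⟨fun x y ↦ cond x (cond y v11 v10) (cond y v01 v00), ?_⟩
    simp only [SameAverages, Bool.forall_bool, Set.mem_Icc, cond_true, cond_false]
    refine ⟨?_, ⟨⟨e1, e2⟩, e3, e4⟩, ⟨h2, h3⟩, h1, h4⟩
    refine ⟨⟨⟨?_, ?_⟩, ?_, ?_⟩, ⟨?_, ?_⟩, ?_, ?_⟩ <;> linarith
  generalize m false false = x00 at *
  generalize m false true = x01 at *
  generalize m true false = x10 at *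
  generalize m true true = x11 at *
  obtain ⟨q, hq⟩ : ∃ q, q = (1 - a) * x10 + a * x11 := ⟨_, rfl⟩
  obtain ⟨r, hr⟩ : ∃ r, r = (1 - b) * x00 + b * x10 := ⟨_, rfl⟩
  obtain ⟨s, hs⟩ : ∃ s, s = (1 - b) * x01 + b * x11 := ⟨_, rfl⟩
  obtain ⟨p, hp⟩ : ∃ p, p = (1 - a) * x00 + a * x01 := ⟨_, rfl⟩
  have hcons : (1 - b) * p + b * q = (1 - a) * r + a * s := by
    rw [hp, hq, hr, hs]; ring
  have hq1 : q ≤ 1 := by nlinarith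
  have hr0 : 0 ≤ r := hr ▸ by positivity
  have hp0 : 0 ≤ p := hp ▸ by positivity
  have hrx : b * x10 ≤ r := by nlinarith
  clear hm
  rw [← hq] at hle ⊢
  rw [← hr] at hcol ⊢
  rw [← hs] at hcol hle ⊢
  rw [← hp]
  have solve {t : ℝ} (ht : 0 < t) (z : ℝ) : ∃ v, t * v = z := ⟨z / t, mul_div_cancel₀ z ht.ne'⟩
  rcases le_or_gt (b * q) r with h | h
  · obtain ⟨v00, e00⟩ := solve hb1' (r - b * q)
    obtain ⟨v01, e01⟩ := solve hb1' (s - b * q)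
    have hv : v01 ≤ q := le_of_mul_le_mul_left (by linarith) hb1'
    have hv' : v00 ≤ v01 := le_of_mul_le_mul_left (by linarith) hb1'
    refine ⟨v00, v01, q, q, ?_, hv', hv'.trans hv, hv, le_rfl, hq1, ?_, by ring, by linarith,
      by linarith⟩
    · exact nonneg_of_mul_nonneg_right (by linarith) hb1'
    · refine mul_left_cancel₀ hb1'.ne' ?_
      linear_combination (1 - a) * e00 + a * e01 - hcons
  · obtain ⟨v10, e10⟩ := solve hb0 r
    obtain ⟨v01, e01⟩ := solve ha0 p
    obtain ⟨v11, e11⟩ := solve ha0 (q - (1 - a) * v10)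
    have hv10 : v10 < q := lt_of_mul_lt_mul_left (by linarith) hb0.le
    have hqv : q ≤ v11 := le_of_mul_le_mul_left (by nlinarith) ha0
    have hcol' : (1 - b) * v01 + b * v11 = s := by
      refine mul_left_cancel₀ ha0.ne' ?_
      linear_combination (1 - b) * e01 + b * e11 + hcons - (1 - a) * e10
    have hxv : x10 ≤ v10 := le_of_mul_le_mul_left (by linarith) hb0
    have hvx : v11 ≤ x11 := le_of_mul_le_mul_left (by nlinarith) ha0
    refine ⟨0, v01, v10, v11, le_rfl, ?_, ?_, ?_, by linarith, by linarith, by linarith,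
      by linarith, by linarith, hcol'⟩
    · exact nonneg_of_mul_nonneg_right (by linarith) ha0
    · exact nonneg_of_mul_nonneg_right (by linarith) hb0
    · by_contra! hlt
      nlinarith

lemma exists_monotone_of_averages_le {a b : ℝ} (ha : a ∈ Set.Ioo (0 : ℝ) 1)
    (hb : b ∈ Set.Ioo (0 : ℝ) 1) {m : Bool → Bool → ℝ} (hm : ∀ x y, m x y ∈ Set.Icc (0 : ℝ) 1)
    (hrow : (1 - a) * m false false + a * m false true ≤ (1 - a) * m true false + a * m true true)
    (hcol : (1 - b) * m false false + b * m true false ≤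
      (1 - b) * m false true + b * m true true) :
    ∃ m' : Bool → Bool → ℝ, (∀ x y, m' x y ∈ Set.Icc (0 : ℝ) 1) ∧ SameAverages a b m m' ∧
      (∀ y, m' false y ≤ m' true y) ∧ ∀ x, m' x false ≤ m' x true := by
  rcases le_total ((1 - b) * m false true + b * m true true)
    ((1 - a) * m true false + a * m true true) with h | h
  · exact exists_monotone_of_col_le_row ha hb hm hcol h
  · obtain ⟨m', hm', hav, hx, hy⟩ :=
      exists_monotone_of_col_le_row (m := fun y x ↦ m x y) hb ha (fun y x ↦ hm x y) hrow h
    exact ⟨fun x y ↦ m' y x, fun x y ↦ hm' y x, hav.symm, hy, hx⟩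

/-- The four averages of a weighted `2 × 2` table in `[0, 1]` are those of a table whose rows, as
well as columns, are pointwise comparable. -/
lemma exists_comparable_sameAverages {a b : ℝ} (ha : a ∈ Set.Ioo (0 : ℝ) 1)
    (hb : b ∈ Set.Ioo (0 : ℝ) 1) {m : Bool → Bool → ℝ} (hm : ∀ x y, m x y ∈ Set.Icc (0 : ℝ) 1) :
    ∃ m' : Bool → Bool → ℝ, (∀ x y, m' x y ∈ Set.Icc (0 : ℝ) 1) ∧ SameAverages a b m m' ∧
      ((∀ y, m' false y ≤ m' true y) ∨ ∀ y, m' true y ≤ m' false y) ∧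
      ((∀ x, m' x false ≤ m' x true) ∨ ∀ x, m' x true ≤ m' x false) := by
  wlog hrow : (1 - a) * m false false + a * m false true ≤
      (1 - a) * m true false + a * m true true generalizing b m
  · obtain ⟨m', hm', hav, hx, hy⟩ := this (b := 1 - b) (m := fun x y ↦ m (!x) y)
      ⟨sub_pos.2 hb.2, sub_lt_self _ hb.1⟩ (fun x y ↦ hm _ y) (le_of_not_ge hrow)
    refine ⟨fun x y ↦ m' (!x) y, fun x y ↦ hm' _ y, ⟨fun x ↦ ?_, fun y ↦ ?_⟩, hx.symm, ?_⟩
    · simpa using hav.1 (!x)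
    · have := hav.2 y
      simp only [Bool.not_false, Bool.not_true] at this ⊢
      linarith
    · exact hy.imp (fun h x ↦ h _) fun h x ↦ h _
  wlog hcol : (1 - b) * m false false + b * m true false ≤
      (1 - b) * m false true + b * m true true generalizing a m
  · obtain ⟨m', hm', hav, hx, hy⟩ := this (a := 1 - a) (m := fun x y ↦ m x (!y))
      ⟨sub_pos.2 ha.2, sub_lt_self _ ha.1⟩ (fun x y ↦ hm x _)
      (by simp only [Bool.not_false, Bool.not_true]; linarith) (le_of_not_ge hcol)
    refine ⟨fun x y ↦ m' x (!y), fun x y ↦ hm' x _, ⟨fun x ↦ ?_, fun y ↦ ?_⟩, ?_, hy.symm⟩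
    · have := hav.1 x
      simp only [Bool.not_false, Bool.not_true] at this ⊢
      linarith
    · simpa using hav.2 (!y)
    · exact hx.imp (fun h y ↦ h _) fun h y ↦ h _
  obtain ⟨m', hm', hav, hx, hy⟩ := exists_monotone_of_averages_le ha hb hm hrow hcol
  exact ⟨m', hm', hav, .inl hx, .inl hy⟩

lemma mix_min_of_comparable {t : ℝ} (ht : t ∈ Set.Ioo (0 : ℝ) 1) {u v : Bool → ℝ}
    (h : (∀ i, u i ≤ v i) ∨ ∀ i, v i ≤ u i) :
    (1 - t) * min (u false) (v false) + t * min (u true) (v true) =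
      min ((1 - t) * u false + t * u true) ((1 - t) * v false + t * v true) := by
  have ht0 := ht.1.le
  have ht1 : 0 ≤ 1 - t := sub_nonneg.2 ht.2.le
  rcases h with h | h
  · rw [min_eq_left (h _), min_eq_left (h _), min_eq_left (by gcongr <;> exact h _)]
  · rw [min_eq_right (h _), min_eq_right (h _), min_eq_right (by gcongr <;> exact h _)]

/-- **Proposition 1.** If the structural causal marginal problem is feasible at all,
it is feasible at `λ_A^max = min(p₀₀,p₀₁)` and `λ_B^max = min(p'₀₀,p'₀₁)` simultaneously. -/
theorem prop_lambda_max (piX piY p00 p01 p00' p01' : ℝ)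
    (hpiX : piX ∈ Set.Ioo (0 : ℝ) 1) (hpiY : piY ∈ Set.Ioo (0 : ℝ) 1)
    (hp00 : p00 ∈ Set.Icc (0 : ℝ) 1) (hp01 : p01 ∈ Set.Icc (0 : ℝ) 1)
    (hp00' : p00' ∈ Set.Icc (0 : ℝ) 1) (hp01' : p01' ∈ Set.Icc (0 : ℝ) 1)
    (hfeas : ∃ (c : Fin 16 → ℝ) (lamA lamB : ℝ),
      c ∈ stdSimplex ℝ (Fin 16) ∧
      (Amat piY).mulVec c = avec p00 p01 lamA ∧
      (Bmat piX).mulVec c = avec p00' p01' lamB) :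
    ∃ cs : Fin 16 → ℝ,
      cs ∈ stdSimplex ℝ (Fin 16) ∧
      (Amat piY).mulVec cs = avec p00 p01 (min p00 p01) ∧
      (Bmat piX).mulVec cs = avec p00' p01' (min p00' p01') := by
  obtain ⟨c, lamA, lamB, hc, hA, hB⟩ := hfeas
  rw [Amat_mulVec piY hc.2] at hA
  rw [Bmat_mulVec piX hc.2] at hB
  obtain ⟨hA0, hA1⟩ := avec_inj hA
  obtain ⟨hB0, hB1⟩ := avec_inj hB
  obtain ⟨m, hm, hav, hx, hy⟩ := exists_comparable_sameAverages hpiY hpiX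
    fun x y ↦ zeroMass_mem_Icc hc x y x y
  obtain ⟨cs, hcs, hmin⟩ := exists_comonotone_coupling hm
  refine ⟨cs, hcs, ?_, ?_⟩
  · rw [Amat_mulVec piY hcs.2]
    simp only [hmin, min_self]
    rw [mix_min_of_comparable hpiY hx, hav.1, hav.1, hA0, hA1]
  · rw [Bmat_mulVec piX hcs.2]
    simp only [hmin, min_self]
    rw [mix_min_of_comparable (u := fun x ↦ m x false) (v := fun x ↦ m x true) hpiX hy,
      hav.2, hav.2, hB0, hB1]
end

section
/- (Lemma 1) Let π_X, π_Y ∈ (0,1) and p_{x0}, p_{x1}, p_{y0}, p_{y1} ∈ [0,1]. Suppose there exist q₀₀, q₀₁, q₁₀, q₁₁ ∈ [0,1] with p_{x0}=(1−π_Y)q₀₀+π_Y q₀₁, p_{x1}=(1−π_Y)q₁₀+π_Y q₁₁, p_{y0}=(1−π_X)q₀₀+π_X q₁₀, p_{y1}=(1−π_X)q₀₁+π_X q₁₁ (the two statistical marginal models can be merged), and suppose δ_X := p_{x1}−p_{x0} ≥ 0 and δ_Y := p_{y1}−p_{y0} ≥ 0. Then there exist q'₀₀, q'₀₁, q'₁₀,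 q'₁₁ ∈ [0,1] satisfying the same four marginal equations and additionally q'₀₀ ≤ q'₀₁ ≤ q'₁₁ and q'₀₀ ≤ q'₁₀ ≤ q'₁₁. -/
/-- **Lemma 1.** If the two statistical marginal models can be merged and
`δ_X = p_{x1}−p_{x0} ≥ 0`, `δ_Y = p_{y1}−p_{y0} ≥ 0`, then they can be merged with
monotone joint conditionals `q'₀₀ ≤ q'₀₁ ≤ q'₁₁` and `q'₀₀ ≤ q'₁₀ ≤ q'₁₁`. -/
theorem lemma_statistical (piX piY px0 px1 py0 py1 : ℝ)
    (hpiX : piX ∈ Set.Ioo (0 : ℝ) 1) (hpiY : piY ∈ Set.Ioo (0 : ℝ) 1)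
    (hpx0 : px0 ∈ Set.Icc (0 : ℝ) 1) (hpx1 : px1 ∈ Set.Icc (0 : ℝ) 1)
    (hpy0 : py0 ∈ Set.Icc (0 : ℝ) 1) (hpy1 : py1 ∈ Set.Icc (0 : ℝ) 1)
    (hmerge : ∃ q00 q01 q10 q11 : ℝ,
      q00 ∈ Set.Icc (0 : ℝ) 1 ∧ q01 ∈ Set.Icc (0 : ℝ) 1 ∧
      q10 ∈ Set.Icc (0 : ℝ) 1 ∧ q11 ∈ Set.Icc (0 : ℝ) 1 ∧
      px0 = (1 - piY) * q00 + piY * q01 ∧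
      px1 = (1 - piY) * q10 + piY * q11 ∧
      py0 = (1 - piX) * q00 + piX * q10 ∧
      py1 = (1 - piX) * q01 + piX * q11)
    (hdX : 0 ≤ px1 - px0) (hdY : 0 ≤ py1 - py0) :
    ∃ q00 q01 q10 q11 : ℝ,
      q00 ∈ Set.Icc (0 : ℝ) 1 ∧ q01 ∈ Set.Icc (0 : ℝ) 1 ∧
      q10 ∈ Set.Icc (0 : ℝ) 1 ∧ q11 ∈ Set.Icc (0 : ℝ) 1 ∧
      px0 = (1 - piY) * q00 + piY * q01 ∧
      px1 = (1 - piY) * q10 + piY * q11 ∧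
      py0 = (1 - piX) * q00 + piX * q10 ∧
      py1 = (1 - piX) * q01 + piX * q11 ∧
      q00 ≤ q01 ∧ q01 ≤ q11 ∧ q00 ≤ q10 ∧ q10 ≤ q11 := by
  obtain ⟨ha0, ha1⟩ := hpiX
  obtain ⟨hb0, hb1⟩ := hpiY
  obtain ⟨q00, q01, q10, q11, h00, h01, h10, h11, e1, e2, e3, e4⟩ := hmerge
  have ha1' : 0 < 1 - piX := sub_pos.2 ha1
  have hb1' : 0 < 1 - piY := sub_pos.2 hb1
  have hab := mul_pos ha0 hb0
  have hab' := mul_pos ha1' hb1'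
  have hmean : (1 - piX) * px0 + piX * px1 = (1 - piY) * py0 + piY * py1 := by
    rw [e1, e2, e3, e4]; ring
  have hX0 := mul_nonneg ha0.le hdX
  have hX1 := mul_nonneg ha1'.le hdX
  have hY0 := mul_nonneg hb0.le hdY
  have hY1 := mul_nonneg hb1'.le hdY
  have hXY : py0 ≤ px1 := by linarith
  have hYX : px0 ≤ py1 := by linarith
  -- The solutions of the marginal equations form a line, parametrised by `t`.
  obtain ⟨t, l1, l2, l3, u1, u2, u3⟩ : ∃ t : ℝ,
      (q10 - q11) / (1 - piX) ≤ t ∧ (q01 - q11) / (1 - piY) ≤ t ∧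
      (-q00) / (piX * piY) ≤ t ∧ t ≤ (q01 - q00) / piX ∧ t ≤ (q10 - q00) / piY ∧
      t ≤ (1 - q11) / ((1 - piX) * (1 - piY)) := by
    refine ⟨max ((q10 - q11) / (1 - piX)) (max ((q01 - q11) / (1 - piY))
      ((-q00) / (piX * piY))), le_max_left _ _,
      (le_max_left _ _).trans (le_max_right _ _),
      (le_max_right _ _).trans (le_max_right _ _), ?_, ?_, ?_⟩
    · refine max_le ?_ (max_le ?_ ?_)
      · rw [div_le_div_iff₀ ha1' ha0]; linarith
      · rw [div_le_div_iff₀ hb1' ha0]; linarith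
      · rw [div_le_div_iff₀ hab ha0]; nlinarith [mul_nonneg ha0.le hpx0.1]
    · refine max_le ?_ (max_le ?_ ?_)
      · rw [div_le_div_iff₀ ha1' hb0]; linarith
      · rw [div_le_div_iff₀ hb1' hb0]; linarith
      · rw [div_le_div_iff₀ hab hb0]; nlinarith [mul_nonneg hb0.le hpy0.1]
    · refine max_le ?_ (max_le ?_ ?_)
      · rw [div_le_div_iff₀ ha1' hab']
        nlinarith [mul_nonneg ha1'.le (sub_nonneg.2 hpx1.2)]
      · rw [div_le_div_iff₀ hb1' hab']
        nlinarith [mul_nonneg hb1'.le (sub_nonneg.2 hpy1.2)]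
      · exact (div_nonpos_of_nonpos_of_nonneg (neg_nonpos.2 h00.1) hab.le).trans
          (div_nonneg (sub_nonneg.2 h11.2) hab'.le)
  rw [div_le_iff₀ ha1'] at l1
  rw [div_le_iff₀ hb1'] at l2
  rw [div_le_iff₀ hab] at l3
  rw [le_div_iff₀ ha0] at u1
  rw [le_div_iff₀ hb0] at u2
  rw [le_div_iff₀ hab'] at u3
  refine ⟨q00 + t * (piX * piY), q01 - t * (piX * (1 - piY)), q10 - t * ((1 - piX) * piY),
    q11 + t * ((1 - piX) * (1 - piY)), ⟨?_, ?_⟩, ⟨?_, ?_⟩, ⟨?_, ?_⟩, ⟨?_, ?_⟩,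
    ?_, ?_, ?_, ?_, ?_, ?_, ?_, ?_⟩ <;> linarith
end

section
/- (Interval nonemptiness in the proof of Lemma 1) Let π_X, π_Y ∈ (0,1) and p_{x0}, p_{x1}, p_{y0}, p_{y1} ∈ [0,1]. Suppose there exist q₀₀, q₀₁, q₁₀, q₁₁ ∈ [0,1] with p_{x0}=(1−π_Y)q₀₀+π_Y q₀₁, p_{x1}=(1−π_Y)q₁₀+π_Y q₁₁, p_{y0}=(1−π_X)q₀₀+π_X q₁₀, p_{y1}=(1−π_X)q₀₁+π_X q₁₁, and that δ_X := p_{x1}−p_{x0} ≥ 0 and δ_Y := p_{y1}−p_{y0} ≥ 0. Define η₂ := p_{x0}, η₃ := p_{y0}, η₄ := p_{y0} − (π_X/(1−π_Y))·δ_X, η₅ := p_{x0} − (π_Y/(1−π_X))·δ_Y, and η₆ := (π_X·π_Y − p_{y1}·π_Y + p_{x0}·(1−π_X)) / ((1−π_X)(1−π_Y)). Then max(0, η₄, η₅) ≤ min(η₂, η₃, η₆). -/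
/-- **Interval nonemptiness in the proof of Lemma 1:** `max(0, η₄, η₅) ≤ min(η₂, η₃, η₆)`. -/
theorem interval_nonempty (piX piY px0 px1 py0 py1 : ℝ)
    (hpiX : piX ∈ Set.Ioo (0 : ℝ) 1) (hpiY : piY ∈ Set.Ioo (0 : ℝ) 1)
    (hpx0 : px0 ∈ Set.Icc (0 : ℝ) 1) (hpx1 : px1 ∈ Set.Icc (0 : ℝ) 1)
    (hpy0 : py0 ∈ Set.Icc (0 : ℝ) 1) (hpy1 : py1 ∈ Set.Icc (0 : ℝ) 1)
    (hmerge : ∃ q00 q01 q10 q11 : ℝ,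
      q00 ∈ Set.Icc (0 : ℝ) 1 ∧ q01 ∈ Set.Icc (0 : ℝ) 1 ∧
      q10 ∈ Set.Icc (0 : ℝ) 1 ∧ q11 ∈ Set.Icc (0 : ℝ) 1 ∧
      px0 = (1 - piY) * q00 + piY * q01 ∧
      px1 = (1 - piY) * q10 + piY * q11 ∧
      py0 = (1 - piX) * q00 + piX * q10 ∧
      py1 = (1 - piX) * q01 + piX * q11)
    (hdX : 0 ≤ px1 - px0) (hdY : 0 ≤ py1 - py0)
    (η₂ η₃ η₄ η₅ η₆ : ℝ)
    (hη₂ : η₂ = px0) (hη₃ : η₃ = py0)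
    (hη₄ : η₄ = py0 - (piX / (1 - piY)) * (px1 - px0))
    (hη₅ : η₅ = px0 - (piY / (1 - piX)) * (py1 - py0))
    (hη₆ : η₆ = (piX * piY - py1 * piY + px0 * (1 - piX)) / ((1 - piX) * (1 - piY))) :
    max 0 (max η₄ η₅) ≤ min η₂ (min η₃ η₆) := by
  obtain ⟨a0, a1⟩ := hpiX
  obtain ⟨b0, b1⟩ := hpiY
  obtain ⟨q00, q01, q10, q11, h00, h01, h10, h11, e1, e2, e3, e4⟩ := hmerge
  have hu : 0 < 1 - piX := sub_pos.2 a1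
  have hv : 0 < 1 - piY := sub_pos.2 b1
  have hab : 0 < piX * piY := mul_pos a0 b0
  have s4 : η₄ = q00 - piX * piY * (q11 - q01) / (1 - piY) := by
    rw [hη₄, e1, e2, e3]; field_simp; ring
  have s5 : η₅ = q00 - piX * piY * (q11 - q10) / (1 - piX) := by
    rw [hη₅, e1, e3, e4]; field_simp; ring
  have s6 : η₆ = q00 + piX * piY * (1 - q11) / ((1 - piX) * (1 - piY)) := by
    rw [hη₆, e1, e4]; field_simp; ring
  have h6 : 0 ≤ η₆ := by
    rw [s6]
    exact add_nonneg h00.1 (div_nonneg (mul_nonneg hab.le (sub_nonneg.2 h11.2)) (by positivity))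
  have h42 : η₄ ≤ px0 := by
    have key : px0 - η₄ =
        piY * ((1 - piY) * (py1 - py0) + piX * (px1 - px0)) / (1 - piY) := by
      rw [s4, e1, e2, e3, e4]; field_simp; ring
    have : 0 ≤ px0 - η₄ := by rw [key]; positivity
    linarith
  have h53 : η₅ ≤ py0 := by
    have key : py0 - η₅ =
        piX * ((1 - piX) * (px1 - px0) + piY * (py1 - py0)) / (1 - piX) := by
      rw [s5, e1, e2, e3, e4]; field_simp; ring
    have : 0 ≤ py0 - η₅ := by rw [key]; positivity
    linarith
  have h43 : η₄ ≤ py0 := by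
    have : 0 ≤ (piX / (1 - piY)) * (px1 - px0) := by positivity
    linarith
  have h52 : η₅ ≤ px0 := by
    have : 0 ≤ (piY / (1 - piX)) * (py1 - py0) := by positivity
    linarith
  have c11 : 0 ≤ 1 - q11 := sub_nonneg.2 h11.2
  have h46 : η₄ ≤ η₆ := by
    have c01 : 0 ≤ 1 - q01 := sub_nonneg.2 h01.2
    have key : η₆ - η₄ = piX * piY * ((1 - piX) * (1 - q01) + piX * (1 - q11)) /
        ((1 - piX) * (1 - piY)) := by
      rw [s6, s4]; field_simp; ring
    have : 0 ≤ η₆ - η₄ := by rw [key]; positivity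
    linarith
  have h56 : η₅ ≤ η₆ := by
    have c10 : 0 ≤ 1 - q10 := sub_nonneg.2 h10.2
    have key : η₆ - η₅ = piX * piY * ((1 - piY) * (1 - q10) + piY * (1 - q11)) /
        ((1 - piX) * (1 - piY)) := by
      rw [s6, s5]; field_simp; ring
    have : 0 ≤ η₆ - η₅ := by rw [key]; positivity
    linarith
  rw [hη₂, hη₃]
  exact max_le (le_min hpx0.1 (le_min hpy0.1 h6))
    (max_le (le_min h42 (le_min h43 h46)) (le_min h52 (le_min h53 h56)))
end

section
/- (Completion of the proof of Lemma 1) Let π_X, π_Y ∈ (0,1) and p_{x0}, p_{x1}, p_{y0}, p_{y1} ∈ [0,1] satisfying the consistency equation (1−π_X)p_{x0} + π_X p_{x1} = (1−π_Y)p_{y0} + π_Y p_{y1}. Define η₂ := p_{x0}, η₃ := p_{y0}, η₄ := p_{y0} − (π_X/(1−π_Y))·(p_{x1}−p_{x0}), η₅ := p_{x0} − (π_Y/(1−π_X))·(p_{y1}−p_{y0}), η₆ := (π_X·π_Y − p_{y1}·π_Y + p_{x0}·(1−π_X)) / ((1−π_X)(1−π_Y)). For any q₀₀ with max(0, η₄,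 η₅) ≤ q₀₀ ≤ min(η₂, η₃, η₆), the back-substituted values q₀₁ := (p_{x0}−(1−π_Y)q₀₀)/π_Y, q₁₀ := (p_{y0}−(1−π_X)q₀₀)/π_X, q₁₁ := (p_{y1}−(1−π_X)q₀₁)/π_X all lie in [0,1], satisfy q₀₀ ≤ q₀₁ ≤ q₁₁ and q₀₀ ≤ q₁₀ ≤ q₁₁, and satisfy all four marginal equations p_{x0}=(1−π_Y)q₀₀+π_Y q₀₁, p_{x1}=(1−π_Y)q₁₀+π_Y q₁₁, p_{y0}=(1−π_X)q₀₀+π_X q₁₀, p_{y1}=(1−π_X)q₀₁+π_X q₁₁. -/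
/-- **Completion of the proof of Lemma 1.** For any `q₀₀` in the interval
`[max(0,η₄,η₅), min(η₂,η₃,η₆)]`, the back-substituted values `q₀₁, q₁₀, q₁₁` lie in `[0,1]`,
are monotone, and satisfy all four marginal equations. -/
theorem lemma_completion (piX piY px0 px1 py0 py1 : ℝ)
    (hpiX : piX ∈ Set.Ioo (0 : ℝ) 1) (hpiY : piY ∈ Set.Ioo (0 : ℝ) 1)
    (hpx0 : px0 ∈ Set.Icc (0 : ℝ) 1) (hpx1 : px1 ∈ Set.Icc (0 : ℝ) 1)
    (hpy0 : py0 ∈ Set.Icc (0 : ℝ) 1) (hpy1 : py1 ∈ Set.Icc (0 : ℝ) 1)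
    (hcons : (1 - piX) * px0 + piX * px1 = (1 - piY) * py0 + piY * py1)
    (η₂ η₃ η₄ η₅ η₆ : ℝ)
    (hη₂ : η₂ = px0) (hη₃ : η₃ = py0)
    (hη₄ : η₄ = py0 - (piX / (1 - piY)) * (px1 - px0))
    (hη₅ : η₅ = px0 - (piY / (1 - piX)) * (py1 - py0))
    (hη₆ : η₆ = (piX * piY - py1 * piY + px0 * (1 - piX)) / ((1 - piX) * (1 - piY)))
    (q00 q01 q10 q11 : ℝ)
    (hq00lo : max 0 (max η₄ η₅) ≤ q00) (hq00hi : q00 ≤ min η₂ (min η₃ η₆))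
    (hq01 : q01 = (px0 - (1 - piY) * q00) / piY)
    (hq10 : q10 = (py0 - (1 - piX) * q00) / piX)
    (hq11 : q11 = (py1 - (1 - piX) * q01) / piX) :
    q00 ∈ Set.Icc (0 : ℝ) 1 ∧ q01 ∈ Set.Icc (0 : ℝ) 1 ∧
    q10 ∈ Set.Icc (0 : ℝ) 1 ∧ q11 ∈ Set.Icc (0 : ℝ) 1 ∧
    q00 ≤ q01 ∧ q01 ≤ q11 ∧ q00 ≤ q10 ∧ q10 ≤ q11 ∧
    px0 = (1 - piY) * q00 + piY * q01 ∧
    px1 = (1 - piY) * q10 + piY * q11 ∧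
    py0 = (1 - piX) * q00 + piX * q10 ∧
    py1 = (1 - piX) * q01 + piX * q11 := by
  obtain ⟨hX0, hX1⟩ := hpiX
  obtain ⟨hY0, hY1⟩ := hpiY
  have hX : 0 < 1 - piX := by linarith
  have hY : 0 < 1 - piY := by linarith
  subst hη₂ hη₃
  simp only [max_le_iff, le_min_iff] at hq00lo hq00hi
  obtain ⟨hlo, h4, h5⟩ := hq00lo
  obtain ⟨h2, h3, h6⟩ := hq00hi
  have mx0 : η₂ = (1 - piY) * q00 + piY * q01 := by
    rw [hq01]; field_simp; ring
  have my0 : η₃ = (1 - piX) * q00 + piX * q10 := by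
    rw [hq10]; field_simp; ring
  have my1 : py1 = (1 - piX) * q01 + piX * q11 := by
    rw [hq11]; field_simp; ring
  have mx1 : px1 = (1 - piY) * q10 + piY * q11 := by
    apply mul_left_cancel₀ hX0.ne'
    linear_combination hcons + (1 - piY) * my0 + piY * my1 - (1 - piX) * mx0
  have h0001 : q00 ≤ q01 := le_of_mul_le_mul_left (by linarith) hY0
  have h0010 : q00 ≤ q10 := le_of_mul_le_mul_left (by linarith) hX0
  have h0111 : q01 ≤ q11 := by
    have key : (1 - piY) * η₄ = (1 - piY) * η₃ - piX * (px1 - η₂) := by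
      rw [hη₄]; field_simp
    have := mul_le_mul_of_nonneg_left h4 hY.le
    have h : q01 ≤ py1 := le_of_mul_le_mul_left (by linarith) hY0
    exact le_of_mul_le_mul_left (by linarith) hX0
  have h1011 : q10 ≤ q11 := by
    have key : (1 - piX) * η₅ = (1 - piX) * η₂ - piY * (py1 - η₃) := by
      rw [hη₅]; field_simp
    have := mul_le_mul_of_nonneg_left h5 hX.le
    have h : q10 ≤ px1 := le_of_mul_le_mul_left (by linarith) hX0
    exact le_of_mul_le_mul_left (by linarith) hY0
  have h11 : q11 ≤ 1 := by
    rw [hη₆, le_div_iff₀ (mul_pos hX hY)] at h6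
    refine le_of_mul_le_mul_left ?_ (mul_pos hX0 hY0)
    rw [mx0, my1] at h6
    linarith
  exact ⟨⟨hlo, by linarith⟩, ⟨by linarith, by linarith⟩, ⟨by linarith, by linarith⟩,
    ⟨by linarith, h11⟩, h0001, h0111, h0010, h1011, mx0, mx1, my0, my1⟩
end

section
/- (Upper bound η₆ always dominates η₄ and η₅) Let π_X, π_Y ∈ (0,1) and q₀₀, q₀₁, q₁₀, q₁₁ ∈ [0,1]. Define the induced marginals p_{x0}=(1−π_Y)q₀₀+π_Y q₀₁, p_{x1}=(1−π_Y)q₁₀+π_Y q₁₁, p_{y0}=(1−π_X)q₀₀+π_X q₁₀, p_{y1}=(1−π_X)q₀₁+π_X q₁₁, and set η₄ := p_{y0} − (π_X/(1−π_Y))·(p_{x1}−p_{x0}), η₅ := p_{x0} − (π_Y/(1−π_X))·(p_{y1}−p_{y0}), η₆ := (π_X·π_Y·(1−q₁₁) + (1−π_X)(1−π_Y)·q₀₀) / ((1−π_X)(1−π_Y)). Then η₄ ≤ η₆ and η₅ ≤ η₆ (without any sign assumptions on p_{x1}−p_{x0} or p_{y1}−p_{y0}). -/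
/-- The gap `η₆ - η₄` is a nonnegative multiple of `(1 - a) * (1 - r) + a * (1 - t)`. -/
theorem marginal_bound_le_joint_bound {a b p r s t : ℝ} (ha : a ∈ Set.Ioo (0 : ℝ) 1)
    (hb : b ∈ Set.Ioo (0 : ℝ) 1) (hr : r ≤ 1) (ht : t ≤ 1) :
    ((1 - a) * p + a * s) -
        (a / (1 - b)) * (((1 - b) * s + b * t) - ((1 - b) * p + b * r)) ≤
      (a * b * (1 - t) + (1 - a) * (1 - b) * p) / ((1 - a) * (1 - b)) := by
  obtain ⟨ha0, ha1⟩ := ha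
  obtain ⟨hb0, hb1⟩ := hb
  have ha' : 0 < 1 - a := sub_pos.2 ha1
  have hb' : 0 < 1 - b := sub_pos.2 hb1
  have hr' : 0 ≤ 1 - r := sub_nonneg.2 hr
  have ht' : 0 ≤ 1 - t := sub_nonneg.2 ht
  have gap : 0 ≤ a * b * ((1 - a) * (1 - r) + a * (1 - t)) / ((1 - a) * (1 - b)) := by
    positivity
  rw [← sub_nonneg]
  convert gap using 1
  field_simp
  ring

/-- **Upper bound `η₆` always dominates `η₄` and `η₅`** (no sign assumptions needed). -/
theorem eta6_dominates (piX piY q00 q01 q10 q11 : ℝ)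
    (hpiX : piX ∈ Set.Ioo (0 : ℝ) 1) (hpiY : piY ∈ Set.Ioo (0 : ℝ) 1)
    (hq00 : q00 ∈ Set.Icc (0 : ℝ) 1) (hq01 : q01 ∈ Set.Icc (0 : ℝ) 1)
    (hq10 : q10 ∈ Set.Icc (0 : ℝ) 1) (hq11 : q11 ∈ Set.Icc (0 : ℝ) 1)
    (px0 px1 py0 py1 : ℝ)
    (hpx0 : px0 = (1 - piY) * q00 + piY * q01)
    (hpx1 : px1 = (1 - piY) * q10 + piY * q11)
    (hpy0 : py0 = (1 - piX) * q00 + piX * q10)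
    (hpy1 : py1 = (1 - piX) * q01 + piX * q11)
    (η₄ η₅ η₆ : ℝ)
    (hη₄ : η₄ = py0 - (piX / (1 - piY)) * (px1 - px0))
    (hη₅ : η₅ = px0 - (piY / (1 - piX)) * (py1 - py0))
    (hη₆ : η₆ = (piX * piY * (1 - q11) + (1 - piX) * (1 - piY) * q00) /
      ((1 - piX) * (1 - piY))) :
    η₄ ≤ η₆ ∧ η₅ ≤ η₆ := by
  subst hpx0 hpx1 hpy0 hpy1 hη₄ hη₅ hη₆
  refine ⟨marginal_bound_le_joint_bound hpiX hpiY hq01.2 hq11.2, ?_⟩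
  simpa only [mul_comm piY piX, mul_comm (1 - piY) (1 - piX)] using
    marginal_bound_le_joint_bound (p := q00) (s := q01) hpiY hpiX hq10.2 hq11.2
end

section
/- (Forced zeros from vanishing constant-one and NOT weights, equation (31) of the paper) Let π_X ∈ (0,1) and c ∈ Δ^15. If [B(π_X)·c]₁ = 0 and [B(π_X)·c]₃ = 0 (the marginal Y → Z model assigns zero weight to the constant-one and NOT response functions), then c_k = 0 for every k ∈ {1, 3, 4, 5, 6, 7, 9, 11, 12, 13, 14, 15}; i.e., only c₀, c₂, c₈, c₁₀ can be nonzero. -/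
/-- The entries of `B(π)` are nonnegative for `π ∈ (0,1)`. -/
theorem Bmat_nonneg {p : ℝ} (hp : p ∈ Set.Ioo (0 : ℝ) 1) (j : Fin 4) (k : Fin 16) :
    0 ≤ Bmat p j k := by
  have h0 := hp.1
  have h1 := hp.2
  simp only [Bmat, Matrix.of_apply]
  split_ifs <;> linarith

/-- An entry of `B(π)` is positive as soon as one of the two slices of `h_k` is `f_j`. -/
theorem Bmat_pos {p : ℝ} (hp : p ∈ Set.Ioo (0 : ℝ) 1) {j : Fin 4} {k : Fin 16} {x : Bool}
    (h : (fun y => hRes k x y) = fRes j) : 0 < Bmat p j k := by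
  have h0 := hp.1
  have h1 := hp.2
  simp only [Bmat, Matrix.of_apply]
  cases x
  · rw [if_pos h]
    split_ifs <;> linarith
  · rw [if_pos h]
    split_ifs <;> linarith

/-- If a weighted row sum of `B(π)` vanishes, so does the weight of every `h_k` having the
corresponding response function as a slice. -/
theorem eq_zero_of_Bmat_mulVec_eq_zero {p : ℝ} (hp : p ∈ Set.Ioo (0 : ℝ) 1) {c : Fin 16 → ℝ}
    (hc : ∀ k, 0 ≤ c k) {j : Fin 4} (hj : (Bmat p).mulVec c j = 0) {k : Fin 16} {x : Bool}
    (h : (fun y => hRes k x y) = fRes j) : c k = 0 := by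
  have hk : Bmat p j k * c k = 0 :=
    (Finset.sum_eq_zero_iff_of_nonneg fun i _ => mul_nonneg (Bmat_nonneg hp j i) (hc i)).1
      (by simpa only [Matrix.mulVec, dotProduct] using hj) k
      (Finset.mem_univ k)
  exact (mul_eq_zero.1 hk).resolve_left (Bmat_pos hp h).ne'

/-- Each listed `h_k` has a slice that is constant one or NOT. -/
theorem exists_slice_eq_const_one_or_not :
    ∀ k ∈ ({1, 3, 4, 5, 6, 7, 9, 11, 12, 13, 14, 15} : Finset (Fin 16)),
      ∃ x : Bool, (fun y => hRes k x y) = fRes 1 ∨ (fun y => hRes k x y) = fRes 3 := by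
  decide

/-- **Forced zeros from vanishing constant-one and NOT weights (eq. (31)).** -/
theorem forced_zeros_const_one_not (piX : ℝ) (hpiX : piX ∈ Set.Ioo (0 : ℝ) 1)
    (c : Fin 16 → ℝ) (hc : c ∈ stdSimplex ℝ (Fin 16))
    (h1 : (Bmat piX).mulVec c 1 = 0) (h3 : (Bmat piX).mulVec c 3 = 0) :
    ∀ k ∈ ({1, 3, 4, 5, 6, 7, 9, 11, 12, 13, 14, 15} : Finset (Fin 16)), c k = 0 := by
  intro k hk
  obtain ⟨x, h | h⟩ := exists_slice_eq_const_one_or_not k hk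
  · exact eq_zero_of_Bmat_mulVec_eq_zero hpiX hc.1 h1 h
  · exact eq_zero_of_Bmat_mulVec_eq_zero hpiX hc.1 h3 h
end

section
/- (Construction of a joint response-function distribution from monotone conditionals, key step in the proof of Proposition 1) Let q₀₀, q₀₁, q₁₀, q₁₁ ∈ [0,1] with q₀₀ ≤ q₀₁ ≤ q₁₁ and q₀₀ ≤ q₁₀ ≤ q₁₁. Then there exists c ∈ Δ^15 with c_k = 0 for all k ∉ {0, 1, 3, 5, 7, 15} such that for every (x,y) ∈ {0,1}², the sum of c_k over all k with h_k(x,y) = 0 equals q_{xy}; i.e., the joint response-function distribution c realises the conditionals P(Z=0|X=x, Y=y) = q_{xy} using only the monotone-type response functions h₀, h₁, h₃, h₅, h₇, h₁₅. -/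
/-- **Construction of a joint response-function distribution from monotone conditionals.** -/
theorem monotone_joint_construction (q00 q01 q10 q11 : ℝ)
    (h00 : q00 ∈ Set.Icc (0 : ℝ) 1) (h01 : q01 ∈ Set.Icc (0 : ℝ) 1)
    (h10 : q10 ∈ Set.Icc (0 : ℝ) 1) (h11 : q11 ∈ Set.Icc (0 : ℝ) 1)
    (hm1 : q00 ≤ q01) (hm2 : q01 ≤ q11) (hm3 : q00 ≤ q10) (hm4 : q10 ≤ q11) :
    ∃ c : Fin 16 → ℝ, c ∈ stdSimplex ℝ (Fin 16) ∧
      (∀ k : Fin 16, k ∉ ({0, 1, 3, 5, 7, 15} : Finset (Fin 16)) → c k = 0) ∧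
      ∑ k ∈ Finset.univ.filter (fun k : Fin 16 => hRes k false false = false), c k = q00 ∧
      ∑ k ∈ Finset.univ.filter (fun k : Fin 16 => hRes k false true = false), c k = q01 ∧
      ∑ k ∈ Finset.univ.filter (fun k : Fin 16 => hRes k true false = false), c k = q10 ∧
      ∑ k ∈ Finset.univ.filter (fun k : Fin 16 => hRes k true true = false), c k = q11 := by
  obtain ⟨m, hm00, hm01, hm10, hm11⟩ :
      ∃ m, q00 ≤ m ∧ m ≤ q01 ∧ m ≤ q10 ∧ q01 + q10 - m ≤ q11 := by
    refine ⟨min q01 q10, le_min hm1 hm3, min_le_left _ _, min_le_right _ _, ?_⟩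
    rcases min_choice q01 q10 with h | h <;> rw [h] <;> linarith
  refine ⟨![q00, m - q00, 0, q10 - m, 0, q01 - m, 0, q11 - q01 - q10 + m,
    0, 0, 0, 0, 0, 0, 0, 1 - q11], ⟨fun k => ?_, ?_⟩, fun k hk => ?_, ?_, ?_, ?_, ?_⟩
  · fin_cases k <;> simp <;> linarith [h00.1, h11.2]
  · simp [Fin.sum_univ_succ]
    ring
  · fin_cases k <;> simp_all
  all_goals
    simp [Finset.sum_filter, Fin.sum_univ_succ, hRes, Fin.val_succ]
  all_goals ring
end

section
/- (Counterfactual-consistency constraint in the worked-out example, Section 3.3) Let θ ∈ [1/2, 1), π_X ∈ (0,1), b := ((2θ−1)/(2θ), 0, 1/(2θ), 0), and for λ ∈ ℝ let a(λ) := (λ, λ, 1/2−λ, 1/2−λ). Then there exists c ∈ Δ^15 with A(θ)·c = a(λ) and B(π_X)·c = b if and only if 1−θ ≤ λ ≤ 1/2. In particular, only values λ ∈ [1−θ, 1/2] are counterfactually consistent, and for θ = 1/2 the unique consistent model is λ = 1/2 (in which X has no counterfactual influence on Z). -/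
/-- Rows of `Amat p` applied to `c`, written out. -/
theorem Amat_mulVec_s16 (p : ℝ) (c : Fin 16 → ℝ) :
    (Amat p).mulVec c =
      ![(1 - p) * (c 0 + c 2 + c 8 + c 10) + p * (c 0 + c 1 + c 4 + c 5),
        (1 - p) * (c 5 + c 7 + c 13 + c 15) + p * (c 10 + c 11 + c 14 + c 15),
        (1 - p) * (c 4 + c 6 + c 12 + c 14) + p * (c 8 + c 9 + c 12 + c 13),
        (1 - p) * (c 1 + c 3 + c 9 + c 11) + p * (c 2 + c 3 + c 6 + c 7)] := by
  ext j
  fin_cases j <;>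
    simp [Matrix.mulVec, dotProduct, Amat, Fin.sum_univ_succ, hRes, fRes, funext_iff] <;> ring

/-- Rows of `Bmat p` applied to `c`, written out. -/
theorem Bmat_mulVec_s16 (p : ℝ) (c : Fin 16 → ℝ) :
    (Bmat p).mulVec c =
      ![(1 - p) * (c 0 + c 4 + c 8 + c 12) + p * (c 0 + c 1 + c 2 + c 3),
        (1 - p) * (c 3 + c 7 + c 11 + c 15) + p * (c 12 + c 13 + c 14 + c 15),
        (1 - p) * (c 2 + c 6 + c 10 + c 14) + p * (c 8 + c 9 + c 10 + c 11),
        (1 - p) * (c 1 + c 5 + c 9 + c 13) + p * (c 4 + c 5 + c 6 + c 7)] := by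
  ext j
  fin_cases j <;>
    simp [Matrix.mulVec, dotProduct, Bmat, Fin.sum_univ_succ, hRes, fRes, funext_iff] <;> ring

/-- If two convexly weighted nonnegative quantities sum to zero, both vanish. -/
theorem eq_zero_of_convex_comb_eq_zero {p u v : ℝ} (hp : p ∈ Set.Ioo (0 : ℝ) 1)
    (hu : 0 ≤ u) (hv : 0 ≤ v) (h : (1 - p) * u + p * v = 0) : u = 0 ∧ v = 0 := by
  have hp' : 0 < 1 - p := by linarith [hp.2]
  have h1 := mul_nonneg hp'.le hu
  have h2 := mul_nonneg hp.1.le hv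
  exact ⟨(mul_eq_zero.1 (by linarith)).resolve_left hp'.ne',
    (mul_eq_zero.1 (by linarith)).resolve_left hp.1.ne'⟩

/-- The counterfactually consistent values of `lam` are exactly those in `[1 - θ, 1/2]`. -/
theorem exists_joint_iff (θ piX : ℝ)
    (hθ : θ ∈ Set.Ico (1 / 2 : ℝ) 1) (hpiX : piX ∈ Set.Ioo (0 : ℝ) 1) (lam : ℝ) :
    (∃ c : Fin 16 → ℝ, c ∈ stdSimplex ℝ (Fin 16) ∧
        (Amat θ).mulVec c = ![lam, lam, 1 / 2 - lam, 1 / 2 - lam] ∧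
        (Bmat piX).mulVec c = ![(2 * θ - 1) / (2 * θ), 0, 1 / (2 * θ), 0]) ↔
      (1 - θ ≤ lam ∧ lam ≤ 1 / 2) := by
  have hθ0 : 0 < θ := by linarith [hθ.1]
  have hθ1 : 0 ≤ 1 - θ := by linarith [hθ.2]
  constructor
  · rintro ⟨c, ⟨hc, hsum⟩, hA, hB⟩
    rw [Amat_mulVec_s16] at hA
    rw [Bmat_mulVec_s16] at hB
    have hA0 := congrFun hA 0
    have hA2 := congrFun hA 2
    have hB1 := congrFun hB 1
    have hB3 := congrFun hB 3
    simp only [Matrix.cons_val] at hA0 hA2 hB1 hB3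
    have nn : ∀ i j k l, 0 ≤ c i + c j + c k + c l := fun i j k l => by
      linarith [hc i, hc j, hc k, hc l]
    obtain ⟨h1, h2⟩ := eq_zero_of_convex_comb_eq_zero hpiX (nn _ _ _ _) (nn _ _ _ _) hB1
    obtain ⟨h3, h4⟩ := eq_zero_of_convex_comb_eq_zero hpiX (nn _ _ _ _) (nn _ _ _ _) hB3
    have hone : 1 ≤ c 0 + c 2 + c 8 + c 10 := by
      have hsum' : c 0 + c 1 + c 2 + c 3 + c 4 + c 5 + c 6 + c 7 + c 8 + c 9 + c 10 + c 11
          + c 12 + c 13 + c 14 + c 15 = 1 := by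
        rw [← hsum]
        simp [Fin.sum_univ_succ]
        ring
      linarith [hc 5, hc 7, hc 13, hc 15]
    constructor
    · have := mul_le_mul_of_nonneg_left hone hθ1
      have := mul_nonneg hθ0.le (nn 0 1 4 5)
      linarith
    · have := mul_nonneg hθ1 (nn 4 6 12 14)
      have := mul_nonneg hθ0.le (nn 8 9 12 13)
      linarith
  · rintro ⟨hl, hu⟩
    have h0 : 0 ≤ (lam - (1 - θ)) / θ := div_nonneg (by linarith) hθ0.le
    have h2 : 0 ≤ (1 / 2 - lam) / θ := div_nonneg (by linarith) hθ0.le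
    have h10 : 0 ≤ lam / θ := div_nonneg (by linarith) hθ0.le
    refine ⟨![(lam - (1 - θ)) / θ, 0, (1 / 2 - lam) / θ, 0, 0, 0, 0, 0,
      (1 / 2 - lam) / θ, 0, lam / θ, 0, 0, 0, 0, 0], ⟨?_, ?_⟩, ?_, ?_⟩
    · intro k
      fin_cases k <;> first | exact h0 | exact h2 | exact h10 | exact le_rfl
    · simp [Fin.sum_univ_succ]
      field_simp
      ring
    · rw [Amat_mulVec_s16]
      ext j
      fin_cases j <;> simp <;> field_simp
      ring
    · rw [Bmat_mulVec_s16]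
      ext j
      fin_cases j <;> simp <;> field_simp <;> ring

/-- **Counterfactual-consistency constraint in the worked-out example (Section 3.3).**
A marginal `X → Z` model `a(λ)` is counterfactually consistent with the unique `Y → Z`
model `b` iff `1−θ ≤ λ ≤ 1/2`; for `θ = 1/2` the unique consistent model is `λ = 1/2`. -/
theorem worked_example_constraint (θ piX : ℝ)
    (hθ : θ ∈ Set.Ico (1 / 2 : ℝ) 1) (hpiX : piX ∈ Set.Ioo (0 : ℝ) 1) (lam : ℝ) :
    ((∃ c : Fin 16 → ℝ, c ∈ stdSimplex ℝ (Fin 16) ∧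
        (Amat θ).mulVec c = ![lam, lam, 1 / 2 - lam, 1 / 2 - lam] ∧
        (Bmat piX).mulVec c = ![(2 * θ - 1) / (2 * θ), 0, 1 / (2 * θ), 0]) ↔
      (1 - θ ≤ lam ∧ lam ≤ 1 / 2)) ∧
    (θ = 1 / 2 →
      ((∃ c : Fin 16 → ℝ, c ∈ stdSimplex ℝ (Fin 16) ∧
          (Amat θ).mulVec c = ![lam, lam, 1 / 2 - lam, 1 / 2 - lam] ∧
          (Bmat piX).mulVec c = ![(2 * θ - 1) / (2 * θ), 0, 1 / (2 * θ), 0]) ↔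
        lam = 1 / 2)) := by
  have key := exists_joint_iff θ piX hθ hpiX lam
  refine ⟨key, fun h => key.trans ?_⟩
  subst h
  constructor
  · rintro ⟨h1, h2⟩
    linarith
  · rintro rfl
    norm_num
end

section
/- (Illustrative example of Appendix F: full identification of the X → Z SCM) Let π_X = 1/2, π_Y = 2/5, let a(λ) := (λ, 1/10 + λ, 1/2 − λ, 2/5 − λ) for λ ∈ ℝ (the X → Z marginal SCMs consistent with P(Z=0|X=0)=1/2 and P(Z=0|X=1)=2/5), and let b := (1/12, 0, 0, 11/12) (the unique Y → Z response-function distribution consistent with P(Z=0|Y=0)=1/12 and P(Z=0|Y=1)=1). Then: (i) the vector c ∈ Δ^15 with c₄ = 1/6, c₅ = 5/6 and all other entries zero satisfies A(2/5)·c = a(2/5) and B(1/2)·c = b; and (ii) for every c ∈ Δ^15 and λ ∈ ℝ with A(2/5)·c = a(λ) and B(1/2)·c = b, one has λ = 2/5 and c₀ = 0; hence the unique counterfactually consistent X → Z model is a(2/5) = (2/5, 1/2, 1/10, 0), which assigns zero weight to the NOT response function f₃. -/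
/-- Summing against the weights `1/6` at index `4` and `5/6` at index `5`. -/
lemma sum_mul_two_point (g : Fin 16 → ℝ) :
    ∑ k, g k * (if k = 4 then (1 / 6 : ℝ) else if k = 5 then 5 / 6 else 0)
      = g 4 * (1 / 6) + g 5 * (5 / 6) := by
  rw [Fintype.sum_eq_add (4 : Fin 16) 5 (by decide)
    fun k hk => by rw [if_neg hk.1, if_neg hk.2, mul_zero]]
  simp

/-- **Illustrative example of Appendix F: full identification of the X → Z SCM.** -/
theorem illustrative_example :
    ((fun k : Fin 16 => if k = 4 then (1 / 6 : ℝ) else if k = 5 then 5 / 6 else 0)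
        ∈ stdSimplex ℝ (Fin 16) ∧
      (Amat (2 / 5)).mulVec
          (fun k : Fin 16 => if k = 4 then (1 / 6 : ℝ) else if k = 5 then 5 / 6 else 0)
        = avec (1 / 2) (2 / 5) (2 / 5) ∧
      (Bmat (1 / 2)).mulVec
          (fun k : Fin 16 => if k = 4 then (1 / 6 : ℝ) else if k = 5 then 5 / 6 else 0)
        = ![1 / 12, 0, 0, 11 / 12]) ∧
    (∀ (c : Fin 16 → ℝ) (lam : ℝ), c ∈ stdSimplex ℝ (Fin 16) →
      (Amat (2 / 5)).mulVec c = avec (1 / 2) (2 / 5) lam →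
      (Bmat (1 / 2)).mulVec c = ![1 / 12, 0, 0, 11 / 12] →
      lam = 2 / 5 ∧ c 0 = 0) ∧
    avec (1 / 2) (2 / 5) (2 / 5) = ![2 / 5, 1 / 2, 1 / 10, 0] := by
  refine ⟨⟨⟨fun k => ?_, ?_⟩, ?_, ?_⟩, fun c lam ⟨hnn, hsum⟩ hA hB => ?_, ?_⟩
  · dsimp only
    split_ifs <;> norm_num
  · have h := sum_mul_two_point fun _ => 1
    simp only [one_mul] at h
    rw [h]
    norm_num
  · ext j
    rw [Matrix.mulVec, dotProduct, sum_mul_two_point]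
    fin_cases j <;> simp [Amat, avec, fRes, hRes, funext_iff] <;> norm_num
  · ext j
    rw [Matrix.mulVec, dotProduct, sum_mul_two_point]
    fin_cases j <;> simp [Bmat, fRes, hRes, funext_iff] <;> norm_num
  · have hA0 := congrFun hA 0
    have hA3 := congrFun hA 3
    have hB1 := congrFun hB 1
    have hB2 := congrFun hB 2
    simp [Matrix.mulVec, dotProduct, Amat, Bmat, avec, fRes, hRes, funext_iff,
      Fin.sum_univ_succ] at hsum hA0 hA3 hB1 hB2
    constructor <;>
      linarith [hnn 0, hnn 1, hnn 2, hnn 3, hnn 4, hnn 5, hnn 6, hnn 7, hnn 8, hnn 9, hnn 10,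
        hnn 11, hnn 12, hnn 13, hnn 14, hnn 15]
  · ext j
    fin_cases j <;> norm_num [avec]
end
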